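/- arXiv:1605.08687 — 2 statements merged into one kernel-verified Lean document; each statement's English description precedes it below -/
import Mathlib

section
/- Let m ≥ 2, k ≥ 1, n ≥ 1, let A be an order m dimension n tensor over ℂ and B an order k dimension n tensor over ℂ. Then for every index i ∈ {1,…,n}, the i-th row sum of the general product AB satisfies r_i(AB) ≤ r_i(A)·(R(B))^{m-1}. -/
open Finset

/-- The `i`-th row sum of a tensor of dimension `n` whose "tail" indices
are indexed by `ι` (a tensor of order `Fintype.card ι + 1`). -/
def rS {n : ℕ} {ι : Type} [Fintype ι] [DecidableEq ι] {𝕜 : Type} [RCLike 𝕜]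
    (A : Fin n → (ι → Fin n) → 𝕜) (i : Fin n) : ℝ :=
  ∑ t : ι → Fin n, ‖A i t‖

/-- The general (Shao) product of tensors. -/
def gP {n : ℕ} {ι κ : Type} [Fintype ι] [DecidableEq ι] [Fintype κ] [DecidableEq κ]
    {𝕜 : Type} [RCLike 𝕜]
    (A : Fin n → (ι → Fin n) → 𝕜) (B : Fin n → (κ → Fin n) → 𝕜) :
    Fin n → (ι × κ → Fin n) → 𝕜 :=
  fun i α => ∑ t : ι → Fin n, A i t * ∏ j : ι, B (t j) (fun l => α (j, l))

/-- Maximum of a real-valued function on `Fin n`, `n ≥ 1`. -/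
def maxF {n : ℕ} (hn : 1 ≤ n) (f : Fin n → ℝ) : ℝ :=
  Finset.univ.sup' ⟨⟨0, hn⟩, Finset.mem_univ _⟩ f

/-- Minimum of a real-valued function on `Fin n`, `n ≥ 1`. -/
def minF {n : ℕ} (hn : 1 ≤ n) (f : Fin n → ℝ) : ℝ :=
  Finset.univ.inf' ⟨⟨0, hn⟩, Finset.mem_univ _⟩ f

/-- `lam` is an eigenvalue of the tensor `T`. -/
def IsEig {n : ℕ} {ι : Type} [Fintype ι] [DecidableEq ι]
    (T : Fin n → (ι → Fin n) → ℂ) (lam : ℂ) : Prop :=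
  ∃ x : Fin n → ℂ, x ≠ 0 ∧ ∀ i : Fin n,
    (∑ t : ι → Fin n, T i t * ∏ j : ι, x (t j)) = lam * x i ^ (Fintype.card ι)

/-- Tail-index type of the `(j+1)`-st power of a tensor with tail-index type `ι`. -/
def PowIdx (ι : Type) : ℕ → Type
  | 0 => ι
  | j + 1 => ι × PowIdx ι j

instance PowIdx.instFintype (ι : Type) [Fintype ι] : (j : ℕ) → Fintype (PowIdx ι j)
  | 0 => inferInstanceAs (Fintype ι)
  | j + 1 => letI := PowIdx.instFintype ι j; inferInstanceAs (Fintype (ι × PowIdx ι j))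

instance PowIdx.instDecEq (ι : Type) [DecidableEq ι] : (j : ℕ) → DecidableEq (PowIdx ι j)
  | 0 => inferInstanceAs (DecidableEq ι)
  | j + 1 => letI := PowIdx.instDecEq ι j; inferInstanceAs (DecidableEq (ι × PowIdx ι j))

/-- `tpow A j` is the `(j+1)`-st power `A^(j+1)` of `A` under the general product:
`tpow A 0 = A` and `tpow A (j+1) = A * (tpow A j)`. -/
def tpow {n : ℕ} {ι : Type} [Fintype ι] [DecidableEq ι] {𝕜 : Type} [RCLike 𝕜]
    (A : Fin n → (ι → Fin n) → 𝕜) : (j : ℕ) → Fin n → (PowIdx ι j → Fin n) → 𝕜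
  | 0 => A
  | j + 1 => gP A (tpow A j)

/-- The arc relation of the digraph associated with a tensor. -/
def Arc {n : ℕ} {ι : Type} [Fintype ι] [DecidableEq ι]
    (T : Fin n → (ι → Fin n) → ℂ) (i j : Fin n) : Prop :=
  ∃ t : ι → Fin n, T i t ≠ 0 ∧ (∃ l, t l = j) ∧ t ≠ fun _ => i

/-- `γ` is a circuit of the digraph associated with `T`: a nonempty list of
pairwise distinct vertices with arcs between consecutive vertices and an arc
from the last vertex back to the first. -/
def IsCircuit {n : ℕ} {ι : Type} [Fintype ι] [DecidableEq ι]
    (T : Fin n → (ι → Fin n) → ℂ) (γ : List (Fin n)) : Prop :=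
  ∃ h : γ ≠ [], γ.Nodup ∧ List.Chain' (Arc T) γ ∧ Arc T (γ.getLast h) (γ.head h)

theorem rS_gP_le {n : ℕ} {ι κ : Type} [Fintype ι] [DecidableEq ι] [Fintype κ] [DecidableEq κ]
    {𝕜 : Type} [RCLike 𝕜] (A : Fin n → (ι → Fin n) → 𝕜) (B : Fin n → (κ → Fin n) → 𝕜)
    (i : Fin n) : rS (gP A B) i ≤ ∑ t : ι → Fin n, ‖A i t‖ * ∏ j, rS B (t j) := by
  calc rS (gP A B) i
      ≤ ∑ α : ι × κ → Fin n, ∑ t : ι → Fin n, ‖A i t‖ * ∏ j, ‖B (t j) (fun l => α (j, l))‖ := by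
        refine sum_le_sum fun α _ => (norm_sum_le _ _).trans_eq ?_
        simp only [norm_mul, norm_prod]
    _ = ∑ t : ι → Fin n, ‖A i t‖ *
          ∑ α : ι × κ → Fin n, ∏ j, ‖B (t j) (fun l => α (j, l))‖ := by
        rw [sum_comm]
        simp only [mul_sum]
    _ = ∑ t : ι → Fin n, ‖A i t‖ * ∏ j, rS B (t j) := by
        refine sum_congr rfl fun t _ => ?_
        congr 1
        simp only [rS, Fintype.prod_sum]
        exact Fintype.sum_equiv (Equiv.curry ι κ (Fin n)) _ _ fun _ => rfl

theorem rS_nonneg {n : ℕ} {ι : Type} [Fintype ι] [DecidableEq ι] {𝕜 : Type} [RCLike 𝕜]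
    (A : Fin n → (ι → Fin n) → 𝕜) (i : Fin n) : 0 ≤ rS A i :=
  sum_nonneg fun _ _ => norm_nonneg _

theorem le_maxF {n : ℕ} (hn : 1 ≤ n) (f : Fin n → ℝ) (i : Fin n) : f i ≤ maxF hn f :=
  le_sup' f (mem_univ i)

/-- For tensors `A` (order `m`) and `B` (order `k`) over ℂ,
`r_i(AB) ≤ r_i(A) · (R(B))^(m-1)` for every `i`. -/
theorem stmt0 (m k n : ℕ) (hm : 2 ≤ m) (hk : 1 ≤ k) (hn : 1 ≤ n)
    (A : Fin n → (Fin (m - 1) → Fin n) → ℂ)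
    (B : Fin n → (Fin (k - 1) → Fin n) → ℂ) (i : Fin n) :
    rS (gP A B) i ≤ rS A i * (maxF hn (rS B)) ^ (m - 1) := by
  refine (rS_gP_le A B i).trans ?_
  rw [rS, sum_mul]
  refine sum_le_sum fun t _ => mul_le_mul_of_nonneg_left ?_ (norm_nonneg _)
  calc ∏ j, rS B (t j) ≤ ∏ _j : Fin (m - 1), maxF hn (rS B) :=
        prod_le_prod (fun j _ => rS_nonneg B (t j)) fun j _ => le_maxF hn (rS B) (t j)
    _ = maxF hn (rS B) ^ (m - 1) := by simp
end

section
/- Let m ≥ 2, n ≥ 1, let A be an order m dimension n tensor over ℂ, and let D = diag(d₁,…,d_n) be an invertible diagonal matrix (each d_i ∈ ℂ, d_i ≠ 0). Define the order m dimension n tensor B with entries b_{i₁i₂⋯i_m} = d_{i₁}^{-(m-1)} a_{i₁i₂⋯i_m} d_{i₂}⋯d_{i_m}. Then A and B have the same eigenvalues: λ ∈ ℂ is an eigenvalue of A if and only if λ is an eigenvalue of B. -/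
open Finset

/-- The eigenvalue equations of a tensor at `d * y` are equivalent to those of its diagonal
similar tensor at `y`. -/
theorem diagonalSimilar_eigenEquation_iff {n : ℕ} {ι : Type} [Fintype ι] [DecidableEq ι]
    (A : Fin n → (ι → Fin n) → ℂ) (d y : Fin n → ℂ) (lam : ℂ) (i : Fin n) (hd : d i ≠ 0) :
    (∑ t : ι → Fin n, (d i)⁻¹ ^ Fintype.card ι * A i t * (∏ j, d (t j)) * ∏ j, y (t j)) =
        lam * y i ^ Fintype.card ι ↔
      (∑ t : ι → Fin n, A i t * ∏ j, (d (t j) * y (t j))) =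
        lam * (d i * y i) ^ Fintype.card ι := by
  simp only [Finset.prod_mul_distrib, mul_assoc, ← Finset.mul_sum]
  rw [inv_pow, inv_mul_eq_iff_eq_mul₀ (pow_ne_zero _ hd), mul_pow, mul_left_comm]

/-- A tensor and its diagonal similar tensor have the same eigenvalues. -/
theorem isEig_diagonalSimilar_iff {n : ℕ} {ι : Type} [Fintype ι] [DecidableEq ι]
    (A : Fin n → (ι → Fin n) → ℂ) (d : Fin n → ℂ) (hd : ∀ i, d i ≠ 0) (lam : ℂ) :
    IsEig A lam ↔
      IsEig (fun i t => (d i)⁻¹ ^ Fintype.card ι * A i t * ∏ j, d (t j)) lam := by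
  constructor
  · rintro ⟨x, hx, h⟩
    have hdx : ∀ i, d i * ((d i)⁻¹ * x i) = x i := fun i => mul_inv_cancel_left₀ (hd i) _
    refine ⟨fun i => (d i)⁻¹ * x i, fun h0 => hx ?_, fun i => ?_⟩
    · ext i
      simpa [hd i] using congrFun h0 i
    · rw [diagonalSimilar_eigenEquation_iff A d (fun i => (d i)⁻¹ * x i) lam i (hd i)]
      simpa only [hdx] using h i
  · rintro ⟨y, hy, h⟩
    refine ⟨fun i => d i * y i, fun h0 => hy ?_, fun i => ?_⟩
    · ext i
      simpa [hd i] using congrFun h0 i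
    · exact (diagonalSimilar_eigenEquation_iff A d y lam i (hd i)).1 (h i)

/-- a tensor `A` and its diagonal similar tensor
`B = D^{-(m-1)} A D`, where `D = diag(d₁,…,d_n)` is invertible, have the same
eigenvalues. -/
theorem stmt19 (m n : ℕ) (hm : 2 ≤ m) (hn : 1 ≤ n)
    (A : Fin n → (Fin (m - 1) → Fin n) → ℂ)
    (d : Fin n → ℂ) (hd : ∀ i, d i ≠ 0) (lam : ℂ) :
    IsEig A lam ↔
      IsEig (fun i₁ t => (d i₁)⁻¹ ^ (m - 1) * A i₁ t * ∏ j : Fin (m - 1), d (t j)) lam := by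
  simpa only [Fintype.card_fin] using isEig_diagonalSimilar_iff A d hd lam
end
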